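/- For any density matrices ρ, σ on ℂ^d and α ∈ [0,1], and any c with 0 ≤ c ≤ 1/(log d)², exp(c·H(ρ ⊞_α σ)) ≥ α·exp(c·H(ρ)) + (1−α)·exp(c·H(σ)), where ρ ⊞_α σ = α ρ + (1−α) σ − √(α(1−α)) i[ρ,σ]. -/

import Mathlib

open Matrix
open scoped ComplexOrder

open scoped Classical in
/-- The von Neumann entropy of a matrix, via its eigenvalues (natural logarithm). -/
noncomputable def vnEntropy {d : ℕ} (ρ : Matrix (Fin d) (Fin d) ℂ) : ℝ :=
  if h : ρ.IsHermitian then ∑ i, Real.negMulLog (h.eigenvalues i) else 0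

/-- The partial swap addition rule ρ ⊞_α σ. -/
noncomputable def boxplus {d : ℕ} (α : ℝ) (ρ σ : Matrix (Fin d) (Fin d) ℂ) :
    Matrix (Fin d) (Fin d) ℂ :=
  (α : ℂ) • ρ + ((1 - α : ℝ) : ℂ) • σ
    - ((Real.sqrt (α * (1 - α)) : ℂ) * Complex.I) • (ρ * σ - σ * ρ)

theorem one_add_sq_add_pow_four_le_cosh (u : ℝ) : 1 + u ^ 2 / 2 + u ^ 4 / 24 ≤ Real.cosh u := by
  have h := sum_le_hasSum (Finset.range 3)
    (fun n _ => div_nonneg (by rw [pow_mul]; positivity) (by positivity)) (Real.hasSum_cosh u)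
  norm_num [Finset.sum_range_succ, Nat.factorial] at h
  linarith

theorem abs_le_log_two_mul_cosh (u : ℝ) : |u| ≤ Real.log 2 * Real.cosh u := by
  rw [← Real.cosh_abs]
  have h1 := one_add_sq_add_pow_four_le_cosh |u|
  have h2 := Real.log_two_gt_d9
  set v := |u|
  have hv : 0 ≤ v := abs_nonneg u
  have h3 : v ≤ 0.693 * (1 + v ^ 2 / 2 + v ^ 4 / 24) := by
    nlinarith [sq_nonneg (v ^ 2 - 1.44), sq_nonneg (v - 1.2)]
  nlinarith [Real.cosh_pos v]

theorem mul_one_sub_mul_sq_log_sub_log_le {x : ℝ} (hx0 : 0 < x) (hx1 : x < 1) :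
    x * (1 - x) * (Real.log x - Real.log (1 - x)) ^ 2 ≤ Real.log 2 ^ 2 := by
  have hy : 0 < 1 - x := by linarith
  set u := (Real.log x - Real.log (1 - x)) / 2 with hu
  have hc : Real.cosh u ^ 2 * (4 * (x * (1 - x))) = 1 := by
    have h2 : Real.cosh (2 * u) = (x / (1 - x) + (1 - x) / x) / 2 := by
      rw [Real.cosh_eq, show 2 * u = Real.log x - Real.log (1 - x) by rw [hu]; ring,
        neg_sub, Real.exp_sub, Real.exp_sub, Real.exp_log hx0, Real.exp_log hy]
    have h3 : Real.cosh u ^ 2 = (Real.cosh (2 * u) + 1) / 2 := by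
      rw [Real.cosh_two_mul, Real.sinh_sq]; ring
    rw [h3, h2]
    field_simp
    ring
  have h1 : u ^ 2 ≤ (Real.log 2 * Real.cosh u) ^ 2 :=
    sq_le_sq.mpr ((abs_le_log_two_mul_cosh u).trans (le_abs_self _))
  have hxy : 0 < x * (1 - x) := mul_pos hx0 hy
  calc x * (1 - x) * (Real.log x - Real.log (1 - x)) ^ 2
      = 4 * (x * (1 - x)) * u ^ 2 := by rw [hu]; ring
    _ ≤ 4 * (x * (1 - x)) * (Real.log 2 * Real.cosh u) ^ 2 := by gcongr
    _ = Real.log 2 ^ 2 * (Real.cosh u ^ 2 * (4 * (x * (1 - x)))) := by ring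
    _ = Real.log 2 ^ 2 := by rw [hc, mul_one]

theorem mul_log_add_sq_le {x : ℝ} (hx0 : 0 ≤ x) (hx1 : x ≤ 1) :
    x * (Real.log x + 0.6) ^ 2 ≤ 0.36 := by
  rcases hx0.eq_or_lt with rfl | hx
  · norm_num
  obtain ⟨w, hw⟩ : ∃ w, w = -Real.log x / 2 := ⟨_, rfl⟩
  have hw0 : 0 ≤ w := by linarith [Real.log_nonpos hx0 hx1]
  have hlog : Real.log x = -(2 * w) := by linarith
  have hxe : x * Real.exp w ^ 2 = 1 := by
    rw [← Real.exp_log hx, hlog, ← Real.exp_nat_mul, ← Real.exp_add]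
    norm_num
  have he : 1 + w + w ^ 2 / 2 + w ^ 3 / 6 ≤ Real.exp w := by
    have := Real.sum_le_exp_of_nonneg hw0 4
    norm_num [Finset.sum_range_succ, Nat.factorial] at this
    linarith
  have h1 : 2 * w - 0.6 ≤ 0.6 * Real.exp w := by
    nlinarith [sq_nonneg (w - 1.3), mul_nonneg hw0 (sq_nonneg (w - 1.3))]
  have h2 : -(0.6 * Real.exp w) ≤ 2 * w - 0.6 := by nlinarith [Real.one_le_exp hw0]
  have h3 : (2 * w - 0.6) ^ 2 ≤ (0.6 * Real.exp w) ^ 2 := sq_le_sq' h2 h1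
  calc x * (Real.log x + 0.6) ^ 2 = x * (2 * w - 0.6) ^ 2 := by rw [hlog]; ring
    _ ≤ x * (0.6 * Real.exp w) ^ 2 := by gcongr
    _ = 0.36 * (x * Real.exp w ^ 2) := by ring
    _ = 0.36 := by rw [hxe, mul_one]

/-- The tangent line of `x ↦ x * (log x) ^ 2` at `exp (-L)` dominates it on `[0, 1]`. -/
theorem mul_log_sq_le_tangent {L x : ℝ} (hL : 2 ≤ L) (hx0 : 0 ≤ x) (hx1 : x ≤ 1) :
    x * Real.log x ^ 2 ≤
      L ^ 2 * Real.exp (-L) + (L ^ 2 - 2 * L) * (x - Real.exp (-L)) := by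
  rcases hx0.eq_or_lt with rfl | hx
  · have := Real.exp_pos (-L)
    simp only [zero_mul, zero_sub]
    nlinarith
  obtain ⟨m, hm⟩ : ∃ m, m = -Real.log x - L := ⟨_, rfl⟩
  have hlog : Real.log x = -m - L := by linarith
  have hmL : -L ≤ m := by linarith [Real.log_nonpos hx0 hx1]
  have hxe : Real.exp (-L) = x * Real.exp m := by
    rw [← Real.exp_log hx, hlog, ← Real.exp_add]
    congr 1
    ring
  have key : m ^ 2 ≤ 2 * L * (Real.exp m - 1 - m) := by
    rcases le_total 0 m with h | h
    · have := Real.quadratic_le_exp_of_nonneg h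
      nlinarith [sq_nonneg m]
    · have h1 := Real.le_log_one_add_of_nonneg (x := Real.exp (-m) - 1)
        (by linarith [Real.one_le_exp (neg_nonneg.mpr h)])
      rw [show 1 + (Real.exp (-m) - 1) = Real.exp (-m) by ring, Real.log_exp,
        div_le_iff₀ (by linarith [Real.exp_pos (-m)])] at h1
      have h2 : Real.exp m * Real.exp (-m) = 1 := by rw [← Real.exp_add]; simp
      have h3 : m ^ 2 ≤ (2 - m) * (Real.exp m - 1 - m) := by
        nlinarith [mul_le_mul_of_nonneg_left h1 (Real.exp_pos m).le]
      have h4 : 0 ≤ Real.exp m - 1 - m := by linarith [Real.add_one_le_exp m]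
      nlinarith
  rw [hxe, hlog]
  nlinarith [mul_le_mul_of_nonneg_left key hx0]

theorem le_one_of_sum_eq_one {d : ℕ} {p : Fin d → ℝ} (hp : ∀ i, 0 ≤ p i) (hs : ∑ i, p i = 1)
    (i : Fin d) : p i ≤ 1 :=
  hs ▸ Finset.single_le_sum (fun j _ => hp j) (Finset.mem_univ i)

theorem exists_sum_mul_log_add_sq_le {d : ℕ} (hd : 2 ≤ d) (p : Fin d → ℝ) (hp : ∀ i, 0 ≤ p i)
    (hsum : ∑ i, p i = 1) :
    ∃ t : ℝ, ∑ i, p i * (Real.log (p i) + t) ^ 2 ≤ Real.log d ^ 2 := by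
  have hp1 : ∀ i, p i ≤ 1 := le_one_of_sum_eq_one hp hsum
  rcases Nat.lt_or_ge d 8 with hd8 | hd8
  · rcases hd.eq_or_lt with rfl | hd3
    · rw [Fin.sum_univ_two] at hsum
      obtain ⟨x, hx⟩ : ∃ x, x = p 0 := ⟨_, rfl⟩
      have hy : p 1 = 1 - x := by linarith
      simp only [Fin.sum_univ_two, ← hx, hy, Nat.cast_ofNat]
      rcases (hp 0).eq_or_lt with h0 | h0
      · exact ⟨0, by simp [hx, ← h0]; positivity⟩
      rcases (hp1 0).eq_or_lt with h1 | h1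
      · exact ⟨0, by simp [hx, h1]; positivity⟩
      · rw [← hx] at h0 h1
        refine ⟨-(x * Real.log x + (1 - x) * Real.log (1 - x)), ?_⟩
        refine le_trans (le_of_eq ?_) (mul_one_sub_mul_sq_log_sub_log_le h0 h1)
        ring
    · refine ⟨0.6, (Finset.sum_le_sum fun i _ => mul_log_add_sq_le (hp i) (hp1 i)).trans ?_⟩
      simp only [Finset.sum_const, Finset.card_univ, Fintype.card_fin, nsmul_eq_mul]
      have h3 := Real.log_three_gt_d9
      have h5 := Real.log_five_gt_d9
      have h4 : Real.log 3 ≤ Real.log 4 := Real.log_le_log (by norm_num) (by norm_num)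
      have h6 : Real.log 5 ≤ Real.log 6 := Real.log_le_log (by norm_num) (by norm_num)
      have h7 : Real.log 5 ≤ Real.log 7 := Real.log_le_log (by norm_num) (by norm_num)
      have h4' : Real.log 4 = 2 * Real.log 2 := by
        rw [← Real.log_rpow (by norm_num)]; norm_num
      have h2 := Real.log_two_gt_d9
      interval_cases d <;> push_cast <;> nlinarith
  · have hd0 : (0 : ℝ) < d := by positivity
    have hL : 2 ≤ Real.log d := by
      have h8 : Real.log 8 = 3 * Real.log 2 := by
        rw [← Real.log_rpow (by norm_num)]; norm_num
      have : Real.log 8 ≤ Real.log d :=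
        Real.log_le_log (by norm_num) (by exact_mod_cast hd8)
      linarith [Real.log_two_gt_d9]
    refine ⟨0, ?_⟩
    simp only [add_zero]
    refine (Finset.sum_le_sum fun i _ => mul_log_sq_le_tangent hL (hp i) (hp1 i)).trans ?_
    rw [Real.exp_neg, Real.exp_log hd0, Finset.sum_add_distrib, ← Finset.mul_sum,
      ← Finset.mul_sum, Finset.sum_sub_distrib, hsum]
    simp only [Finset.sum_const, Finset.card_univ, Fintype.card_fin, nsmul_eq_mul]
    rw [mul_inv_cancel₀ hd0.ne', sub_self, mul_zero, add_zero, mul_one]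

theorem sq_sum_mul_log_le {d : ℕ} (hd : 2 ≤ d) (p v : Fin d → ℝ) (hp : ∀ i, 0 ≤ p i)
    (hsum : ∑ i, p i = 1) (hv : ∑ i, v i = 0) (hpv : ∀ i, p i = 0 → v i = 0) :
    (∑ i, v i * (-Real.log (p i) - 1)) ^ 2 ≤ Real.log d ^ 2 * ∑ i, v i ^ 2 / p i := by
  obtain ⟨t, ht⟩ := exists_sum_mul_log_add_sq_le hd p hp hsum
  have h1 : ∑ i, v i * (-Real.log (p i) - 1) = -∑ i, v i * (Real.log (p i) + t) := by
    have : ∑ i, v i * (-Real.log (p i) - 1) + ∑ i, v i * (Real.log (p i) + t)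
        = (t - 1) * ∑ i, v i := by
      rw [← Finset.sum_add_distrib, Finset.mul_sum]
      exact Finset.sum_congr rfl fun i _ => by ring
    rw [hv] at this
    linarith
  rw [h1, neg_sq]
  have hq : ∀ i, 0 ≤ v i ^ 2 / p i := fun i => div_nonneg (sq_nonneg _) (hp i)
  calc _ ≤ (∑ i, p i * (Real.log (p i) + t) ^ 2) * ∑ i, v i ^ 2 / p i := by
        refine Finset.sum_sq_le_sum_mul_sum_of_sq_le_mul _
          (fun i _ => mul_nonneg (hp i) (sq_nonneg _)) (fun i _ => hq i) fun i _ => le_of_eq ?_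
        by_cases h : p i = 0
        · simp [h, hpv i h]
        · field_simp
    _ ≤ _ := mul_le_mul_of_nonneg_right ht (Finset.sum_nonneg fun i _ => hq i)

/-- The function `p ↦ exp (c * H p)` of the Shannon entropy is concave on the simplex. -/
theorem exp_mul_entropy_concave {d : ℕ} (hd : 2 ≤ d) {c : ℝ} (hc0 : 0 ≤ c)
    (hc : c ≤ 1 / Real.log d ^ 2) (p q : Fin d → ℝ) (hp : ∀ i, 0 ≤ p i) (hq : ∀ i, 0 ≤ q i)
    (hps : ∑ i, p i = 1) (hqs : ∑ i, q i = 1) {a b : ℝ} (ha : 0 ≤ a) (hb : 0 ≤ b)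
    (hab : a + b = 1) :
    a * Real.exp (c * ∑ i, Real.negMulLog (p i)) + b * Real.exp (c * ∑ i, Real.negMulLog (q i)) ≤
      Real.exp (c * ∑ i, Real.negMulLog (a * p i + b * q i)) := by
  let v : Fin d → ℝ := fun i => q i - p i
  let r : ℝ → Fin d → ℝ := fun t i => p i + t * v i
  let h : ℝ → ℝ := fun t => ∑ i, Real.negMulLog (r t i)
  let h' : ℝ → ℝ := fun t => ∑ i, v i * (-Real.log (r t i) - 1)
  let h'' : ℝ → ℝ := fun t => ∑ i, -(v i ^ 2 / r t i)
  have hr : ∀ i, ∀ t, HasDerivAt (fun t => r t i) (v i) t := fun i t => by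
    have := ((hasDerivAt_id t).mul_const (v i)).const_add (p i)
    rwa [one_mul] at this
  have hpos : ∀ t ∈ Set.Ioo (0 : ℝ) 1, ∀ i, v i ≠ 0 → 0 < r t i := by
    intro t ht i hvi
    have hri : r t i = (1 - t) * p i + t * q i := by simp only [r, v]; ring
    have h1 : 0 ≤ (1 - t) * p i := mul_nonneg (by linarith [ht.2]) (hp i)
    have h2 : 0 ≤ t * q i := mul_nonneg ht.1.le (hq i)
    rw [hri]
    rcases (hp i).eq_or_lt with h0 | h0
    · have hqi : 0 < q i := lt_of_le_of_ne (hq i) fun h => hvi (by simp [v, ← h0, ← h])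
      linarith [mul_pos ht.1 hqi]
    · linarith [mul_pos (sub_pos.mpr ht.2) h0]
  have hh' : ∀ t ∈ Set.Ioo (0 : ℝ) 1, HasDerivAt h (h' t) t := by
    intro t ht
    refine HasDerivAt.fun_sum fun i _ => ?_
    by_cases hvi : v i = 0
    · simpa [r, hvi] using hasDerivAt_const t (Real.negMulLog (p i))
    · have := (Real.hasDerivAt_negMulLog (hpos t ht i hvi).ne').comp t (hr i t)
      rwa [mul_comm] at this
  have hh'' : ∀ t ∈ Set.Ioo (0 : ℝ) 1, HasDerivAt h' (h'' t) t := by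
    intro t ht
    refine HasDerivAt.fun_sum fun i _ => ?_
    by_cases hvi : v i = 0
    · simpa [hvi] using hasDerivAt_const t (0 : ℝ)
    · have := ((((hr i t).log (hpos t ht i hvi).ne').neg.sub_const 1).const_mul (v i))
      exact this.congr_deriv (by ring)
  have hconc : ConcaveOn ℝ (Set.Icc (0 : ℝ) 1) fun t => Real.exp (c * h t) := by
    refine concaveOn_of_hasDerivWithinAt2_nonpos (convex_Icc 0 1)
      (f' := fun t => Real.exp (c * h t) * (c * h' t))
      (f'' := fun t => Real.exp (c * h t) * (c * h' t) * (c * h' t)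
        + Real.exp (c * h t) * (c * h'' t)) ?_ ?_ ?_ ?_
    · refine Continuous.continuousOn ?_
      simp only [h, r]
      fun_prop
    · intro t ht
      rw [interior_Icc] at ht
      exact ((hh' t ht).const_mul c).exp.hasDerivWithinAt
    · intro t ht
      rw [interior_Icc] at ht
      exact (((hh' t ht).const_mul c).exp.mul ((hh'' t ht).const_mul c)).hasDerivWithinAt
    · intro t ht
      rw [interior_Icc] at ht
      have hr0 : ∀ i, 0 ≤ r t i := fun i => by
        by_cases hvi : v i = 0
        · simpa [r, hvi] using hp i
        · exact (hpos t ht i hvi).le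
      have hvs : ∑ i, v i = 0 := by simp [v, Finset.sum_sub_distrib, hps, hqs]
      have hrs : ∑ i, r t i = 1 := by
        simp [r, Finset.sum_add_distrib, ← Finset.mul_sum, hvs, hps]
      have hcs := sq_sum_mul_log_le hd (r t) v hr0 hrs hvs fun i hi => by
        by_contra hvi
        exact (hpos t ht i hvi).ne' hi
      have hQ : 0 ≤ ∑ i, v i ^ 2 / r t i :=
        Finset.sum_nonneg fun i _ => div_nonneg (sq_nonneg _) (hr0 i)
      have hL : 0 < Real.log d ^ 2 := by
        have : 0 < Real.log d := Real.log_pos (by exact_mod_cast hd)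
        positivity
      have hcL : c * Real.log d ^ 2 ≤ 1 := (le_div_iff₀ hL).mp hc
      have hneg : h'' t = -∑ i, v i ^ 2 / r t i := by simp [h'']
      have h1 : c * h' t ^ 2 + h'' t ≤ 0 := by
        have := mul_le_mul_of_nonneg_left hcs hc0
        have := mul_le_mul_of_nonneg_right hcL hQ
        rw [hneg]
        simp only [h']
        nlinarith
      calc _ = Real.exp (c * h t) * c * (c * h' t ^ 2 + h'' t) := by ring
        _ ≤ 0 := mul_nonpos_of_nonneg_of_nonpos (by positivity) h1
  have := hconc.2 (x := 0) (by simp) (y := 1) (by simp) ha hb hab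
  have hmix : ∀ i, a * p i + b * q i = r b i := fun i => by
    simp only [r, v]
    rw [← eq_sub_iff_add_eq] at hab
    rw [hab]
    ring
  simpa [h, hmix, r, v] using this

theorem last_mul_sum_le_sum_mul {n : ℕ} (c z : Fin (n + 1) → ℝ) (hc : Antitone c)
    (hz : ∀ k, 0 ≤ ∑ i ∈ Finset.Iic k, z i) :
    c (Fin.last n) * ∑ i, z i ≤ ∑ i, c i * z i := by
  induction n with
  | zero => simp
  | succ n ih =>
    have hpart : ∀ k : Fin (n + 1),
        ∑ i ∈ Finset.Iic k, z i.castSucc = ∑ i ∈ Finset.Iic k.castSucc, z i := fun k => by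
      rw [← Fin.map_castSuccEmb_Iic, Finset.sum_map]
      rfl
    have h1 := ih (fun i => c i.castSucc) (fun i => z i.castSucc)
      (fun i j hij => hc (Fin.castSucc_le_castSucc_iff.mpr hij)) fun k => hpart k ▸ hz _
    have h2 : 0 ≤ ∑ i : Fin (n + 1), z i.castSucc := by
      have := hz (Fin.last n).castSucc
      rw [← hpart] at this
      simpa [← Fin.top_eq_last] using this
    have h3 : c (Fin.last (n + 1)) ≤ c (Fin.last n).castSucc := hc (Fin.le_last _)
    rw [Fin.sum_univ_castSucc z, Fin.sum_univ_castSucc fun i => c i * z i]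
    nlinarith [mul_le_mul_of_nonneg_right h3 h2]

theorem sum_antitone_mul_nonneg {d : ℕ} (c z : Fin d → ℝ) (hc : Antitone c)
    (hz : ∀ k, 0 ≤ ∑ i ∈ Finset.Iic k, z i) (hsum : ∑ i, z i = 0) :
    0 ≤ ∑ i, c i * z i := by
  cases d with
  | zero => simp
  | succ n => simpa [hsum] using last_mul_sum_le_sum_mul c z hc hz

theorem negMulLog_le_tangent {x y : ℝ} (hx : 0 < x) (hy : 0 ≤ y) :
    Real.negMulLog y ≤ Real.negMulLog x - (Real.log x + 1) * (y - x) := by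
  rcases hy.eq_or_lt with rfl | hy
  · simp only [Real.negMulLog]
    nlinarith
  · have h := Real.log_le_sub_one_of_pos (div_pos hx hy)
    rw [Real.log_div hx.ne' hy.ne'] at h
    have h2 : y * (x / y) = x := by field_simp
    simp only [Real.negMulLog]
    nlinarith [mul_le_mul_of_nonneg_left h hy.le]

/-- The Shannon entropy is Schur concave. -/
theorem entropy_le_of_majorized {d : ℕ} (x y : Fin d → ℝ) (hx : Antitone x)
    (hx0 : ∀ i, 0 ≤ x i) (hy0 : ∀ i, 0 ≤ y i)
    (hpart : ∀ k, ∑ i ∈ Finset.Iic k, x i ≤ ∑ i ∈ Finset.Iic k, y i)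
    (hsum : ∑ i, x i = ∑ i, y i) :
    ∑ i, Real.negMulLog (y i) ≤ ∑ i, Real.negMulLog (x i) := by
  have hz : ∀ k, 0 ≤ ∑ i ∈ Finset.Iic k, (y i - x i) := fun k => by
    rw [Finset.sum_sub_distrib]; linarith [hpart k]
  have hzs : ∑ i, (y i - x i) = 0 := by rw [Finset.sum_sub_distrib]; linarith
  have hsupp : ∀ i, x i = 0 → y i = 0 := by
    have h1 := sum_antitone_mul_nonneg (fun i => if 0 < x i then 1 else 0) _
      (fun i j hij => by
        have := hx hij
        dsimp only
        split_ifs <;> linarith) hz hzs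
    have h2 : ∑ i, (if 0 < x i then 0 else y i) ≤ 0 := by
      have : ∑ i, (if 0 < x i then (1 : ℝ) else 0) * (y i - x i)
          + ∑ i, (if 0 < x i then 0 else y i) = ∑ i, (y i - x i) := by
        rw [← Finset.sum_add_distrib]
        refine Finset.sum_congr rfl fun i _ => ?_
        split_ifs with h
        · ring
        · rw [le_antisymm (not_lt.mp h) (hx0 i)]; ring
      linarith
    intro i hi
    have h3 := Finset.single_le_sum (f := fun i => if 0 < x i then 0 else y i)
      (fun j _ => by split_ifs; exacts [le_rfl, hy0 j]) (Finset.mem_univ i)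
    simp only [hi, lt_irrefl, if_false] at h3
    exact le_antisymm (h3.trans h2) (hy0 i)
  obtain ⟨δ, hδ, hδx⟩ : ∃ δ > 0, ∀ i, 0 < x i → δ ≤ x i := by
    rcases (Finset.univ.filter fun i => 0 < x i).eq_empty_or_nonempty with h | h
    · exact ⟨1, one_pos, fun i hi =>
        absurd hi (Finset.filter_eq_empty_iff.mp h (Finset.mem_univ i))⟩
    · obtain ⟨m, hm, hmin⟩ := Finset.exists_min_image _ x h
      exact ⟨x m, (Finset.mem_filter.mp hm).2, fun i hi => hmin i (by simpa using hi)⟩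
  have hlog := sum_antitone_mul_nonneg (fun i => Real.log (max (x i) δ)) _
    (fun i j hij => Real.log_le_log (lt_max_of_lt_right hδ) (max_le_max_right _ (hx hij))) hz hzs
  have hterm : ∀ i, Real.negMulLog (y i) ≤
      Real.negMulLog (x i) - (Real.log (max (x i) δ) * (y i - x i) + (y i - x i)) := fun i => by
    rcases (hx0 i).eq_or_lt with h | h
    · simp [← h, hsupp i h.symm]
    · rw [max_eq_left (hδx i h)]
      linarith [negMulLog_le_tangent h (hy0 i)]
  refine (Finset.sum_le_sum fun i _ => hterm i).trans ?_
  rw [Finset.sum_sub_distrib, Finset.sum_add_distrib, hzs]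
  linarith

theorem sum_mul_add_sum_sq_sub_mul_le {d : ℕ} (p w : Fin d → ℝ) (g : Fin d → Fin d → ℝ)
    (hp : Antitone p) (hp0 : ∀ i, 0 ≤ p i) (hp1 : ∀ i, p i ≤ 1) (hg : ∀ i j, 0 ≤ g i j)
    (hsymm : ∀ i j, g i j = g j i) (hrow : ∀ i, ∑ j, g i j = w i) (hdiag : ∀ i, g i i = w i ^ 2)
    (k : Fin d) (hw : ∑ i, w i = (Finset.Iic k).card) :
    ∑ i, p i * w i + ∑ i, ∑ j, (p i ^ 2 - p i * p j) * g i j ≤ ∑ i ∈ Finset.Iic k, p i := by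
  set s : Fin d → ℝ := fun i => if i ≤ k then 1 else 0
  have hs : ∀ f : Fin d → ℝ, ∑ i ∈ Finset.Iic k, f i = ∑ i, f i * s i := fun f => by
    simp [s, ← Finset.sum_filter, Finset.filter_ge_eq_Iic]
  set y : Fin d → ℝ := fun i => p i - p k with hy
  have hbound : ∑ i, ∑ j, (p i ^ 2 - p i * p j) * g i j ≤ ∑ i, |y i| * (w i - w i ^ 2) := by
    have hswap : ∑ i, ∑ j, (p i ^ 2 - p i * p j) * g i j
        = ∑ i, ∑ j, (p j ^ 2 - p i * p j) * g i j := by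
      rw [Finset.sum_comm]
      refine Finset.sum_congr rfl fun i _ => Finset.sum_congr rfl fun j _ => ?_
      rw [hsymm j i]; ring
    have hdouble : 2 * ∑ i, ∑ j, (p i ^ 2 - p i * p j) * g i j
        = ∑ i, ∑ j, (p i - p j) ^ 2 * g i j := by
      rw [two_mul]
      nth_rewrite 2 [hswap]
      simp only [← Finset.sum_add_distrib]
      refine Finset.sum_congr rfl fun i _ => Finset.sum_congr rfl fun j _ => ?_
      ring
    have hentry : ∀ i j, (p i - p j) ^ 2 * g i j ≤
        (|y i| + |y j|) * (g i j - if i = j then w i ^ 2 else 0) := fun i j => by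
      split_ifs with h
      · subst h; simp [hdiag]
      · rw [sub_zero]
        refine mul_le_mul_of_nonneg_right ?_ (hg i j)
        have h1 : |p i - p j| ≤ 1 :=
          abs_le.mpr ⟨by linarith [hp0 i, hp1 j], by linarith [hp0 j, hp1 i]⟩
        have h2 : |p i - p j| ≤ |y i| + |y j| := by
          rw [show p i - p j = y i - y j by simp [hy]]
          exact abs_sub _ _
        rw [← sq_abs]
        nlinarith [abs_nonneg (p i - p j)]
    have hfst : ∑ i, ∑ j, |y i| * (g i j - if i = j then w i ^ 2 else 0)
        = ∑ i, |y i| * (w i - w i ^ 2) := by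
      refine Finset.sum_congr rfl fun i _ => ?_
      rw [← Finset.mul_sum, Finset.sum_sub_distrib, hrow]
      simp
    have hsnd : ∑ i, ∑ j, |y j| * (g i j - if i = j then w i ^ 2 else 0)
        = ∑ i, |y i| * (w i - w i ^ 2) := by
      rw [Finset.sum_comm, ← hfst]
      refine Finset.sum_congr rfl fun i _ => Finset.sum_congr rfl fun j _ => ?_
      rw [hsymm j i]
      by_cases h : i = j
      · simp [h]
      · simp [h, Ne.symm h]
    have := Finset.sum_le_sum fun i (_ : i ∈ Finset.univ) =>
      Finset.sum_le_sum fun j (_ : j ∈ Finset.univ) => hentry i j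
    simp only [add_mul, Finset.sum_add_distrib, hfst, hsnd] at this
    linarith
  have hcard : ∑ i, p k * (s i - w i) = 0 := by
    rw [← Finset.mul_sum, Finset.sum_sub_distrib, hw]
    have := hs fun _ => 1
    simp only [Finset.sum_const, nsmul_eq_mul, mul_one, one_mul] at this
    rw [this, sub_self, mul_zero]
  have hw1 : ∀ i, 0 ≤ w i := fun i => hrow i ▸ Finset.sum_nonneg fun j _ => hg i j
  have hterm : ∀ i, |y i| * (w i - w i ^ 2) ≤ p i * s i - p i * w i - p k * (s i - w i) :=
    fun i => by
      have heq : p i * s i - p i * w i - p k * (s i - w i) = y i * (s i - w i) := by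
        simp only [hy]; ring
      rw [heq]
      by_cases h : i ≤ k
      · have hyi : 0 ≤ y i := sub_nonneg.mpr (hp h)
        simp only [s, if_pos h, abs_of_nonneg hyi]
        nlinarith [mul_nonneg hyi (sq_nonneg (1 - w i))]
      · have hyi : y i ≤ 0 := sub_nonpos.mpr (hp (not_le.mp h).le)
        simp only [s, if_neg h, abs_of_nonpos hyi]
        nlinarith [mul_nonneg (neg_nonneg.mpr hyi) (sq_nonneg (w i))]
  have hfin := Finset.sum_le_sum fun i (_ : i ∈ Finset.univ) => hterm i
  rw [Finset.sum_sub_distrib, Finset.sum_sub_distrib, hcard] at hfin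
  rw [hs]
  linarith

/-- Spectral decomposition with the eigenvalues listed in decreasing order. -/
theorem exists_antitone_spectral {d : ℕ} {A : Matrix (Fin d) (Fin d) ℂ} (hA : A.IsHermitian) :
    ∃ (e : Equiv.Perm (Fin d)) (W : Matrix (Fin d) (Fin d) ℂ),
      Antitone (hA.eigenvalues ∘ e) ∧ Wᴴ * W = 1 ∧ W * Wᴴ = 1 ∧
      A = W * diagonal (fun i => (hA.eigenvalues (e i) : ℂ)) * Wᴴ := by
  set e := Tuple.sort (fun i => -hA.eigenvalues i)
  set U : Matrix (Fin d) (Fin d) ℂ := hA.eigenvectorUnitary.val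
  have hUU : Uᴴ * U = 1 := Unitary.coe_star_mul_self hA.eigenvectorUnitary
  refine ⟨e, U.submatrix id e, ?_, ?_, ?_, ?_⟩
  · intro i j hij
    exact neg_le_neg_iff.mp (Tuple.monotone_sort (fun i => -hA.eigenvalues i) hij)
  · rw [conjTranspose_submatrix, submatrix_mul _ _ _ _ _ Function.bijective_id |>.symm, hUU,
      submatrix_one_equiv]
  · rw [conjTranspose_submatrix, submatrix_mul_equiv,
      show U * Uᴴ = 1 from Unitary.coe_mul_star_self hA.eigenvectorUnitary, submatrix_id_id]
  · have hD : diagonal (fun i => (hA.eigenvalues (e i) : ℂ))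
        = (diagonal fun i => (hA.eigenvalues i : ℂ)).submatrix e e := by
      rw [submatrix_diagonal_equiv]; rfl
    rw [hD, conjTranspose_submatrix, submatrix_mul_equiv, submatrix_mul_equiv, submatrix_id_id]
    exact hA.spectral_theorem

theorem trace_conj_diagonal_re_bound {d : ℕ} {N : Matrix (Fin d) (Fin d) ℂ} (hN : Nᴴ = N)
    (hNN : N * N = N) (p : Fin d → ℝ) (hp : Antitone p) (hp0 : ∀ i, 0 ≤ p i)
    (hp1 : ∀ i, p i ≤ 1) (k : Fin d) (htr : N.trace = (Finset.Iic k).card) :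
    (N * diagonal (fun i => (p i : ℂ))).trace.re
      + (N * diagonal (fun i => (p i : ℂ)) * (1 - N) * diagonal (fun i => (p i : ℂ))).trace.re
      ≤ ∑ i ∈ Finset.Iic k, p i := by
  have hconj : ∀ i j, N j i = star (N i j) := fun i j => by
    rw [← conjTranspose_apply, hN]
  have hmul : ∀ i j, N i j * N j i = (Complex.normSq (N i j) : ℂ) := fun i j => by
    rw [hconj i j]; exact Complex.mul_conj _
  have hrow : ∀ i, ∑ j, Complex.normSq (N i j) = (N i i).re := fun i => by
    have h := congrFun (congrFun hNN i) i
    rw [mul_apply] at h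
    simp only [hmul] at h
    rw [← h, ← Complex.ofReal_sum, Complex.ofReal_re]
  have him : ∀ i, (N i i).im = 0 := fun i => Complex.conj_eq_iff_im.mp (hconj i i).symm
  have hmain := sum_mul_add_sum_sq_sub_mul_le p (fun i => (N i i).re)
    (fun i j => Complex.normSq (N i j)) hp hp0 hp1 (fun i j => Complex.normSq_nonneg _)
    (fun i j => by rw [hconj i j]; exact (Complex.normSq_conj _).symm) hrow
    (fun i => by rw [Complex.normSq_apply, him]; ring) k (by
      have := congrArg Complex.re htr
      simpa [trace] using this)
  refine le_trans (le_of_eq ?_) hmain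
  congr 1
  · simp [trace, mul_diagonal, mul_comm]
  · have hsplit : N * diagonal (fun i => (p i : ℂ)) * (1 - N) * diagonal (fun i => (p i : ℂ))
        = N * diagonal (fun i => ((p i ^ 2 : ℝ) : ℂ))
          - (N * diagonal fun i => (p i : ℂ)) * (N * diagonal fun i => (p i : ℂ)) := by
      rw [mul_sub, sub_mul, mul_one, Matrix.mul_assoc, diagonal_mul_diagonal]
      simp only [Matrix.mul_assoc]
      push_cast
      simp only [sq]
    have hcross : ((N * diagonal fun i => (p i : ℂ)) * (N * diagonal fun i => (p i : ℂ))).trace.re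
        = ∑ i, ∑ j, p i * p j * Complex.normSq (N i j) := by
      rw [trace, Complex.re_sum]
      refine Finset.sum_congr rfl fun i _ => ?_
      rw [diag_apply, mul_apply, Complex.re_sum]
      refine Finset.sum_congr rfl fun j _ => ?_
      rw [mul_diagonal, mul_diagonal,
        show N i j * (p j : ℂ) * (N j i * (p i : ℂ)) = ((p i * p j : ℝ) : ℂ) * (N i j * N j i) by
          push_cast; ring, hmul, ← Complex.ofReal_mul, Complex.ofReal_re]
    have hsq : (N * diagonal fun i => ((p i ^ 2 : ℝ) : ℂ)).trace.re
        = ∑ i, ∑ j, p i ^ 2 * Complex.normSq (N i j) := by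
      rw [trace, Complex.re_sum]
      refine Finset.sum_congr rfl fun i _ => ?_
      rw [diag_apply, mul_diagonal, Complex.re_mul_ofReal, ← hrow, ← Finset.mul_sum, mul_comm]
    rw [hsplit, trace_sub, Complex.sub_re, hcross, hsq, ← Finset.sum_sub_distrib]
    refine Finset.sum_congr rfl fun i _ => ?_
    rw [← Finset.sum_sub_distrib]
    exact Finset.sum_congr rfl fun j _ => by ring

/-- A sharpening of the Ky Fan inequality by the weight of the off-diagonal block. -/
theorem trace_projection_re_bound {d : ℕ} {P W ρ : Matrix (Fin d) (Fin d) ℂ} (hP : Pᴴ = P)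
    (hPP : P * P = P) (hW : Wᴴ * W = 1) (hW' : W * Wᴴ = 1) (p : Fin d → ℝ) (hp : Antitone p)
    (hp0 : ∀ i, 0 ≤ p i) (hp1 : ∀ i, p i ≤ 1) (k : Fin d) (htr : P.trace = (Finset.Iic k).card)
    (hρ : ρ = W * diagonal (fun i => (p i : ℂ)) * Wᴴ) :
    (P * ρ).trace.re + (P * ρ * (1 - P) * ρ).trace.re ≤ ∑ i ∈ Finset.Iic k, p i := by
  set D := diagonal (fun i => (p i : ℂ)) with hD
  have hcancel : ∀ X : Matrix (Fin d) (Fin d) ℂ, W * (Wᴴ * X) = X := fun X => by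
    rw [← Matrix.mul_assoc, hW', Matrix.one_mul]
  have hbound := trace_conj_diagonal_re_bound (N := Wᴴ * P * W)
    (by simp [hP, Matrix.mul_assoc])
    (by simp only [Matrix.mul_assoc, hcancel]; rw [← Matrix.mul_assoc P P, hPP])
    p hp hp0 hp1 k (by rw [trace_mul_cycle, hW', Matrix.one_mul, htr])
  rw [← hD] at hbound
  have h1 : (Wᴴ * P * W * D).trace = (P * ρ).trace := by
    rw [hρ, Matrix.mul_assoc, Matrix.mul_assoc, trace_mul_comm]
    simp only [Matrix.mul_assoc]
  have hone : 1 - Wᴴ * P * W = Wᴴ * (1 - P) * W := by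
    rw [mul_sub, sub_mul, mul_one, hW]
  have h2 : (Wᴴ * P * W * D * (1 - Wᴴ * P * W) * D).trace = (P * ρ * (1 - P) * ρ).trace := by
    rw [hone, hρ]
    simp only [Matrix.mul_assoc]
    rw [trace_mul_comm]
    simp only [Matrix.mul_assoc]
  rwa [h1, h2] at hbound

theorem trace_projection_commutator_le {d : ℕ} {P ρ σ : Matrix (Fin d) (Fin d) ℂ} (hP : Pᴴ = P)
    (hPP : P * P = P) (hρ : ρᴴ = ρ) (hσ : σᴴ = σ) {a b : ℝ} (ha : 0 ≤ a) (hb : 0 ≤ b) :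
    -(((Real.sqrt (a * b) : ℂ) * Complex.I) * (P * (ρ * σ - σ * ρ)).trace).re ≤
      a * (P * ρ * (1 - P) * ρ).trace.re + b * (P * σ * (1 - P) * σ).trace.re := by
  obtain ⟨x, hx⟩ : ∃ x : ℂ, x = (Real.sqrt a : ℂ) := ⟨_, rfl⟩
  obtain ⟨y, hy⟩ : ∃ y : ℂ, y = (Real.sqrt b : ℂ) * Complex.I := ⟨_, rfl⟩
  have hxx : x * x = a := by rw [hx, ← Complex.ofReal_mul, Real.mul_self_sqrt ha]
  have hyy : y * y = -b := by
    rw [hy, mul_mul_mul_comm, Complex.I_mul_I, ← Complex.ofReal_mul, Real.mul_self_sqrt hb,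
      mul_neg_one]
  have hxy : (Real.sqrt (a * b) : ℂ) * Complex.I = x * y := by
    rw [hx, hy, Real.sqrt_mul ha]; push_cast; ring
  set R := x • ρ - y • σ with hR
  have hRH : Rᴴ = x • ρ + y • σ := by
    rw [hR, conjTranspose_sub, conjTranspose_smul, conjTranspose_smul, hρ, hσ]
    simp [hx, hy]
  have hQ : (1 - P) * (1 - P) = 1 - P := by
    simp [mul_sub, sub_mul, hPP]
  have hnn : 0 ≤ (P * R * (1 - P) * Rᴴ).trace.re := by
    have h1 := (posSemidef_self_mul_conjTranspose (P * R * (1 - P))).trace_nonneg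
    have h2 : (P * R * (1 - P) * (P * R * (1 - P))ᴴ).trace = (P * R * (1 - P) * Rᴴ).trace := by
      rw [conjTranspose_mul, conjTranspose_mul, conjTranspose_sub, conjTranspose_one, hP]
      rw [show P * R * (1 - P) * ((1 - P) * (Rᴴ * P)) = P * R * ((1 - P) * (1 - P)) * Rᴴ * P by
        simp only [Matrix.mul_assoc], hQ, trace_mul_comm]
      simp only [← Matrix.mul_assoc, hPP]
    rw [h2] at h1
    exact (Complex.le_def.mp h1).1
  have hexp : P * R * (1 - P) * Rᴴ = (a : ℂ) • (P * ρ * (1 - P) * ρ)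
      + (b : ℂ) • (P * σ * (1 - P) * σ) + (x * y) • (P * (ρ * σ - σ * ρ))
      - (x * y) • (P * ρ * (P * σ) - P * σ * (P * ρ)) := by
    rw [hRH, hR, ← hxx, show (b : ℂ) = -(y * y) by rw [hyy, neg_neg]]
    simp only [mul_sub, sub_mul, mul_add, Matrix.mul_smul, Matrix.smul_mul, Matrix.mul_one,
      Matrix.mul_assoc]
    module
  rw [hexp, trace_sub, trace_smul, trace_sub, trace_mul_comm (P * ρ), sub_self, smul_zero,
    sub_zero, trace_add, trace_add, trace_smul, trace_smul, trace_smul] at hnn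
  simp only [smul_eq_mul, Complex.add_re, Complex.re_ofReal_mul] at hnn
  rw [hxy]
  linarith

theorem boxplus_isHermitian {d : ℕ} (α : ℝ) {ρ σ : Matrix (Fin d) (Fin d) ℂ}
    (hρ : ρ.IsHermitian) (hσ : σ.IsHermitian) : (boxplus α ρ σ).IsHermitian := by
  unfold IsHermitian boxplus
  simp only [conjTranspose_sub, conjTranspose_add, conjTranspose_smul, conjTranspose_mul,
    hρ.eq, hσ.eq]
  simp only [star_mul', Complex.star_def, Complex.conj_ofReal, Complex.conj_I]
  module

theorem boxplus_trace {d : ℕ} (α : ℝ) {ρ σ : Matrix (Fin d) (Fin d) ℂ}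
    (hρ : ρ.trace = 1) (hσ : σ.trace = 1) : (boxplus α ρ σ).trace = 1 := by
  simp [boxplus, hρ, hσ, trace_sub, trace_mul_comm ρ σ]

theorem vnEntropy_eq_sum_perm {d : ℕ} {A : Matrix (Fin d) (Fin d) ℂ} (hA : A.IsHermitian)
    (e : Equiv.Perm (Fin d)) :
    vnEntropy A = ∑ i, Real.negMulLog (hA.eigenvalues (e i)) := by
  rw [vnEntropy, dif_pos hA, Equiv.sum_comp e fun i => Real.negMulLog (hA.eigenvalues i)]

theorem sum_eigenvalues_perm_eq_one {d : ℕ} {A : Matrix (Fin d) (Fin d) ℂ} (hA : A.IsHermitian)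
    (htr : A.trace = 1) (e : Equiv.Perm (Fin d)) : ∑ i, hA.eigenvalues (e i) = 1 := by
  rw [Equiv.sum_comp e hA.eigenvalues]
  have := congrArg Complex.re hA.trace_eq_sum_eigenvalues
  rw [htr] at this
  simpa using this.symm

/-- The ordered spectrum of `ρ ⊞_α σ` is majorized by the mixture of the ordered spectra. -/
theorem sum_Iic_eigenvalues_boxplus_le {d : ℕ} {α : ℝ} (hα : α ∈ Set.Icc (0 : ℝ) 1)
    {ρ σ U V W : Matrix (Fin d) (Fin d) ℂ} {x p q : Fin d → ℝ}
    (hρ : ρ.IsHermitian) (hσ : σ.IsHermitian)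
    (hp : Antitone p) (hp0 : ∀ i, 0 ≤ p i) (hp1 : ∀ i, p i ≤ 1)
    (hq : Antitone q) (hq0 : ∀ i, 0 ≤ q i) (hq1 : ∀ i, q i ≤ 1)
    (hU : Uᴴ * U = 1) (hU' : U * Uᴴ = 1) (hV : Vᴴ * V = 1) (hV' : V * Vᴴ = 1)
    (hW : Wᴴ * W = 1)
    (hρd : ρ = U * diagonal (fun i => (p i : ℂ)) * Uᴴ)
    (hσd : σ = V * diagonal (fun i => (q i : ℂ)) * Vᴴ)
    (hτd : boxplus α ρ σ = W * diagonal (fun i => (x i : ℂ)) * Wᴴ) (k : Fin d) :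
    ∑ i ∈ Finset.Iic k, x i ≤ ∑ i ∈ Finset.Iic k, (α * p i + (1 - α) * q i) := by
  set E : Matrix (Fin d) (Fin d) ℂ := diagonal fun i => if i ≤ k then 1 else 0 with hE
  set P := W * E * Wᴴ with hPdef
  have hcancel : ∀ X : Matrix (Fin d) (Fin d) ℂ, Wᴴ * (W * X) = X := fun X => by
    rw [← Matrix.mul_assoc, hW, Matrix.one_mul]
  have hEH : Eᴴ = E := by
    rw [hE, diagonal_conjTranspose]
    congr 1
    ext i
    simp [apply_ite]
  have hEE : E * E = E := by simp [hE]
  have hP : Pᴴ = P := by simp [hPdef, hEH, Matrix.mul_assoc]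
  have hPP : P * P = P := by
    simp only [hPdef, Matrix.mul_assoc, hcancel]
    rw [← Matrix.mul_assoc E E, hEE]
  have htr : P.trace = (Finset.Iic k).card := by
    rw [hPdef, trace_mul_cycle, hW, Matrix.one_mul]
    simp [hE, trace_diagonal, Finset.filter_ge_eq_Iic]
  have hx : (P * boxplus α ρ σ).trace.re = ∑ i ∈ Finset.Iic k, x i := by
    rw [hτd, hPdef]
    simp only [Matrix.mul_assoc, hcancel]
    rw [trace_mul_comm]
    simp only [Matrix.mul_assoc, hW, Matrix.mul_one]
    simp [hE, trace_diagonal, ← Finset.sum_filter, Finset.filter_ge_eq_Iic]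
  have hb : 0 ≤ 1 - α := sub_nonneg.mpr hα.2
  have h1 := trace_projection_re_bound hP hPP hU hU' p hp hp0 hp1 k htr hρd
  have h2 := trace_projection_re_bound hP hPP hV hV' q hq hq0 hq1 k htr hσd
  have h3 := trace_projection_commutator_le hP hPP hρ.eq hσ.eq hα.1 hb
  have h4 : (P * boxplus α ρ σ).trace.re = α * (P * ρ).trace.re + (1 - α) * (P * σ).trace.re
      - (((Real.sqrt (α * (1 - α)) : ℂ) * Complex.I) * (P * (ρ * σ - σ * ρ)).trace).re := by
    rw [boxplus, mul_sub, mul_add, Matrix.mul_smul, Matrix.mul_smul, Matrix.mul_smul, trace_sub,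
      trace_add, trace_smul, trace_smul, trace_smul, Complex.sub_re, Complex.add_re, smul_eq_mul,
      smul_eq_mul, smul_eq_mul, Complex.re_ofReal_mul, Complex.re_ofReal_mul]
  rw [← hx, h4, Finset.sum_add_distrib, ← Finset.mul_sum, ← Finset.mul_sum]
  have h5 := mul_le_mul_of_nonneg_left h1 hα.1
  have h6 := mul_le_mul_of_nonneg_left h2 hb
  linarith

theorem nonneg_of_majorized {d : ℕ} {x y : Fin d → ℝ} (hx : Antitone x) (hy0 : ∀ i, 0 ≤ y i)
    (hpart : ∀ k, ∑ i ∈ Finset.Iic k, x i ≤ ∑ i ∈ Finset.Iic k, y i)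
    (hsum : ∑ i, x i = ∑ i, y i) (i : Fin d) : 0 ≤ x i := by
  by_contra! hi
  have hneg := sum_antitone_mul_nonneg (fun j => if x j < 0 then 0 else 1) (fun j => y j - x j)
    (fun j l hjl => by
      have := hx hjl
      dsimp only
      split_ifs <;> linarith)
    (fun k => by rw [Finset.sum_sub_distrib]; linarith [hpart k])
    (by rw [Finset.sum_sub_distrib]; linarith)
  have hlt : ∑ j, (if x j < 0 then (0 : ℝ) else 1) * (y j - x j) < ∑ j, (y j - x j) := by
    refine Finset.sum_lt_sum (fun j _ => ?_) ⟨i, Finset.mem_univ i, ?_⟩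
    · split_ifs <;> linarith [hy0 j]
    · rw [if_pos hi]
      linarith [hy0 i]
  rw [Finset.sum_sub_distrib] at hlt
  linarith

theorem stmt_15 (d : ℕ) (hd : 2 ≤ d)
    (α : ℝ) (hα : α ∈ Set.Icc (0:ℝ) 1)
    (c : ℝ) (hc : 0 ≤ c ∧ c ≤ 1 / (Real.log d) ^ 2)
    (ρ σ : Matrix (Fin d) (Fin d) ℂ)
    (hρ : ρ.PosSemidef) (hρtr : ρ.trace = 1)
    (hσ : σ.PosSemidef) (hσtr : σ.trace = 1) :
    Real.exp (c * vnEntropy (boxplus α ρ σ))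
      ≥ α * Real.exp (c * vnEntropy ρ) + (1 - α) * Real.exp (c * vnEntropy σ) := by
  have hρH := hρ.isHermitian
  have hσH := hσ.isHermitian
  have hτH := boxplus_isHermitian α hρH hσH
  obtain ⟨e, U, hp, hU, hU', hρd⟩ := exists_antitone_spectral hρH
  obtain ⟨f, V, hq, hV, hV', hσd⟩ := exists_antitone_spectral hσH
  obtain ⟨g, W, hx, hW, -, hτd⟩ := exists_antitone_spectral hτH
  have hb : 0 ≤ 1 - α := sub_nonneg.mpr hα.2
  have hp0 : ∀ i, 0 ≤ hρH.eigenvalues (e i) := fun i => hρ.eigenvalues_nonneg _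
  have hq0 : ∀ i, 0 ≤ hσH.eigenvalues (f i) := fun i => hσ.eigenvalues_nonneg _
  have hps := sum_eigenvalues_perm_eq_one hρH hρtr e
  have hqs := sum_eigenvalues_perm_eq_one hσH hσtr f
  have hpart := sum_Iic_eigenvalues_boxplus_le hα hρH hσH hp hp0 (le_one_of_sum_eq_one hp0 hps)
    hq hq0 (le_one_of_sum_eq_one hq0 hqs) hU hU' hV hV' hW hρd hσd hτd
  have hy0 : ∀ i, 0 ≤ α * hρH.eigenvalues (e i) + (1 - α) * hσH.eigenvalues (f i) := fun i =>
    add_nonneg (mul_nonneg hα.1 (hp0 i)) (mul_nonneg hb (hq0 i))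
  have hsum : ∑ i, hτH.eigenvalues (g i)
      = ∑ i, (α * hρH.eigenvalues (e i) + (1 - α) * hσH.eigenvalues (f i)) := by
    rw [sum_eigenvalues_perm_eq_one hτH (boxplus_trace α hρtr hσtr) g, Finset.sum_add_distrib,
      ← Finset.mul_sum, ← Finset.mul_sum, hps, hqs]
    ring
  have hent := entropy_le_of_majorized _ _ hx (nonneg_of_majorized hx hy0 hpart hsum) hy0 hpart hsum
  rw [vnEntropy_eq_sum_perm hρH e, vnEntropy_eq_sum_perm hσH f, vnEntropy_eq_sum_perm hτH g]
  exact (exp_mul_entropy_concave hd hc.1 hc.2 _ _ hp0 hq0 hps hqs hα.1 hb (by ring)).trans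
    (Real.exp_le_exp.mpr (mul_le_mul_of_nonneg_left hent hc.1))
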